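/- Fix β with 0 < β < +∞. Suppose h : ℍ → ℂ is harmonic, 2-periodic (i.e. h(τ + 2) = h(τ) for all τ ∈ ℍ), and satisfies |h(τ)| = O(exp(πβ/Im τ)) uniformly in τ ∈ ℍ. Then there exist unique coefficients cₙ ∈ ℂ (n ∈ ℤ) such that h(τ) = Σ_{n≥0} cₙ e^{iπnτ} + Σ_{n<0} cₙ e^{iπn·conj(τ)} for all τ ∈ ℍ, with the series converging absolutely and uniformly on compact subsets of ℍ, and these coefficients satisfy |cₙ| = O(exp(2π√(β|n|))) as |n| → +∞. -/

import Mathlib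

open Filter

noncomputable section

/-- A function `h : ℂ → ℂ` is harmonic on the upper half-plane `ℍ` if, writing
`τ = x + iy`, it is twice continuously differentiable as a function of `(x, y)` there
and satisfies `∂²h/∂x² + ∂²h/∂y² = 0` on `ℍ`. -/
def HarmonicOnH (h : ℂ → ℂ) : Prop :=
  ContDiffOn ℝ 2 (fun p : ℝ × ℝ => h ((p.1 : ℂ) + (p.2 : ℂ) * Complex.I))
      {p : ℝ × ℝ | 0 < p.2} ∧
  ∀ τ : ℂ, 0 < τ.im →
    deriv (fun x : ℝ => deriv (fun x' : ℝ => h ((x' : ℂ) + (τ.im : ℂ) * Complex.I)) x) τ.re +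
      deriv (fun y : ℝ => deriv (fun y' : ℝ => h ((τ.re : ℂ) + (y' : ℂ) * Complex.I)) y) τ.im = 0

/-- The `n`-th term of the harmonic Fourier series with coefficients `c : ℤ → ℂ`:
`cₙ e^{iπnτ}` for `n ≥ 0` and `cₙ e^{iπn·conj τ}` for `n < 0`. -/
def fourierTerm (c : ℤ → ℂ) (τ : ℂ) (n : ℤ) : ℂ :=
  c n * Complex.exp (Complex.I * (Real.pi : ℂ) * (n : ℂ) *
    (if 0 ≤ n then τ else starRingEnd ℂ τ))

/-- The harmonic Fourier series with coefficients `c` represents `h` on the upper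
half-plane: it converges pointwise to `h`, converges absolutely, and converges
uniformly on every compact subset of the upper half-plane. -/
def FourierExpansion (c : ℤ → ℂ) (h : ℂ → ℂ) : Prop :=
  (∀ τ : ℂ, 0 < τ.im → HasSum (fun n : ℤ => fourierTerm c τ n) (h τ)) ∧
  (∀ τ : ℂ, 0 < τ.im → Summable (fun n : ℤ => ‖fourierTerm c τ n‖)) ∧
  (∀ K : Set ℂ, K ⊆ {τ : ℂ | 0 < τ.im} → IsCompact K →
    TendstoUniformlyOn (fun (s : Finset ℤ) (τ : ℂ) => ∑ n ∈ s, fourierTerm c τ n) h atTop K)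

open MeasureTheory

theorem isOpen_setOf_snd_pos : IsOpen {p : ℝ × ℝ | 0 < p.2} :=
  isOpen_lt continuous_const continuous_snd

theorem hasDerivAt_fst {F : ℝ × ℝ → ℂ} {x y : ℝ} (hF : DifferentiableAt ℝ F (x, y)) :
    HasDerivAt (fun x' => F (x', y)) (fderiv ℝ F (x, y) (1, 0)) x :=
  HasFDerivAt.comp_hasDerivAt x (f := fun x' : ℝ => (x', y)) hF.hasFDerivAt
    ((hasDerivAt_id x).prodMk (hasDerivAt_const x y))

theorem hasDerivAt_snd {F : ℝ × ℝ → ℂ} {x y : ℝ} (hF : DifferentiableAt ℝ F (x, y)) :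
    HasDerivAt (fun y' => F (x, y')) (fderiv ℝ F (x, y) (0, 1)) y :=
  HasFDerivAt.comp_hasDerivAt y (f := fun y' : ℝ => (x, y')) hF.hasFDerivAt
    ((hasDerivAt_const y x).prodMk (hasDerivAt_id y))

theorem ContinuousOn.comp_row {F : ℝ × ℝ → ℂ} (hF : ContinuousOn F {p | 0 < p.2}) {y : ℝ}
    (hy : 0 < y) : Continuous fun x => F (x, y) :=
  hF.comp_continuous (by fun_prop) fun _ => hy

theorem ContDiffOn.differentiableAt_upper {F : ℝ × ℝ → ℂ} (hF : ContDiffOn ℝ 1 F {p | 0 < p.2})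
    (x : ℝ) {y : ℝ} (hy : 0 < y) : DifferentiableAt ℝ F (x, y) :=
  (hF.differentiableOn one_ne_zero).differentiableAt (isOpen_setOf_snd_pos.mem_nhds hy)

theorem ContDiffOn.continuousOn_fderiv_apply {F : ℝ × ℝ → ℂ}
    (hF : ContDiffOn ℝ 1 F {p | 0 < p.2}) (v : ℝ × ℝ) :
    ContinuousOn (fun p => fderiv ℝ F p v) {p | 0 < p.2} :=
  (hF.continuousOn_fderiv_of_isOpen isOpen_setOf_snd_pos le_rfl).clm_apply continuousOn_const

/-- Differentiation under the integral sign along horizontal segments of the upper half-plane. -/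
theorem hasDerivAt_integral_row {F : ℝ × ℝ → ℂ} (hF : ContDiffOn ℝ 1 F {p | 0 < p.2})
    {φ : ℝ → ℂ} (hφ : Continuous φ) {a b y : ℝ} (hy : 0 < y) :
    HasDerivAt (fun y => ∫ x in a..b, φ x * F (x, y))
      (∫ x in a..b, φ x * fderiv ℝ F (x, y) (0, 1)) y := by
  have hd := hF.continuousOn_fderiv_apply (0, 1)
  have hK : IsCompact (Set.uIcc a b ×ˢ Set.Icc (y / 2) (2 * y)) :=
    isCompact_uIcc.prod isCompact_Icc
  obtain ⟨M, hM⟩ := hK.exists_bound_of_continuousOn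
    (f := fun p : ℝ × ℝ => φ p.1 * fderiv ℝ F p (0, 1))
    ((hφ.comp continuous_fst).continuousOn.mul (hd.mono fun p hp => by
      have := hp.2.1
      change 0 < p.2
      linarith))
  have hs : Set.Ioo (y / 2) (2 * y) ∈ nhds y := Ioo_mem_nhds (by linarith) (by linarith)
  refine (intervalIntegral.hasDerivAt_integral_of_dominated_loc_of_deriv_le
    (F := fun y x => φ x * F (x, y)) (F' := fun y x => φ x * fderiv ℝ F (x, y) (0, 1))
    (bound := fun _ => M) hs ?_ ?_ ?_ ?_ ?_ ?_).2
  · filter_upwards [hs] with z hz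
    exact (hφ.mul (hF.continuousOn.comp_row (by linarith [hz.1]))).aestronglyMeasurable
  · exact (hφ.mul (hF.continuousOn.comp_row hy)).intervalIntegrable _ _
  · exact (hφ.mul (hd.comp_row hy)).aestronglyMeasurable
  · exact .of_forall fun x hx z hz =>
      hM (x, z) ⟨Set.uIoc_subset_uIcc hx, Set.Ioo_subset_Icc_self hz⟩
  · exact intervalIntegrable_const
  · exact .of_forall fun x hx z hz =>
      (hasDerivAt_snd (hF.differentiableAt_upper x (by linarith [hz.1]))).const_mul _

/-- Integration by parts against a character over one period. -/
theorem integral_exp_mul_deriv_of_periodic {g g' : ℝ → ℂ} (hg : ∀ x, HasDerivAt g (g' x) x)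
    (hg' : Continuous g') (hper : g 2 = g 0) (n : ℤ) :
    ∫ x in (0 : ℝ)..2, Complex.exp (-(Complex.I * Real.pi * n * x)) * g' x =
      Complex.I * Real.pi * n *
        ∫ x in (0 : ℝ)..2, Complex.exp (-(Complex.I * Real.pi * n * x)) * g x := by
  have he : ∀ x : ℝ, HasDerivAt (fun x : ℝ => Complex.exp (-(Complex.I * Real.pi * n * x)))
      (Complex.exp (-(Complex.I * Real.pi * n * x)) * -(Complex.I * Real.pi * n * 1)) x :=
    fun x => ((((hasDerivAt_id x).ofReal_comp).const_mul _).neg).cexp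
  rw [intervalIntegral.integral_mul_deriv_eq_deriv_mul (fun x _ => he x) (fun x _ => hg x)
    (Continuous.intervalIntegrable (by fun_prop) _ _) (hg'.intervalIntegrable _ _)]
  have h1 : Complex.exp (-(Complex.I * Real.pi * n * (2 : ℝ))) = 1 := by
    rw [Complex.exp_eq_one_iff]
    exact ⟨-n, by push_cast; ring⟩
  have h0 : Complex.exp (-(Complex.I * Real.pi * n * (0 : ℝ))) = 1 := by simp
  rw [h1, h0, hper, sub_self, zero_sub, ← intervalIntegral.integral_neg,
    ← intervalIntegral.integral_const_mul]
  congr 1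
  ext x
  ring

/-- A solution of `d²a/dy² = k² a` on `(0, ∞)` that is bounded near infinity is a multiple
of `e^{-ky}`. -/
theorem exists_eq_mul_exp_of_bounded {a a' : ℝ → ℂ} {k M : ℝ} (hk : 0 ≤ k)
    (ha : ∀ y, 0 < y → HasDerivAt a (a' y) y)
    (ha' : ∀ y, 0 < y → HasDerivAt a' ((k : ℂ) ^ 2 * a y) y)
    (hM : ∀ y, 1 ≤ y → ‖a y‖ ≤ M) :
    ∃ c : ℂ, ∀ y : ℝ, 0 < y → a y = c * Complex.exp (-(k * y)) := by
  have he : ∀ (s : ℂ) (y : ℝ), HasDerivAt (fun y : ℝ => Complex.exp (s * y))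
      (Complex.exp (s * y) * (s * 1)) y :=
    fun s y => (((hasDerivAt_id y).ofReal_comp).const_mul s).cexp
  have hconst : ∀ f : ℝ → ℂ, (∀ y, 0 < y → HasDerivAt f 0 y) → ∃ d, ∀ y, 0 < y → f y = d := by
    intro f hf
    exact isOpen_Ioi.exists_is_const_of_deriv_eq_zero (isPreconnected_Ioi (a := (0 : ℝ)))
      (fun y hy => (hf y hy).differentiableAt.differentiableWithinAt) fun y hy => (hf y hy).deriv
  obtain ⟨B, hB⟩ := hconst (fun y => (a' y + k * a y) * Complex.exp (-k * y)) fun y hy => by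
    refine (((ha' y hy).add ((ha y hy).const_mul (k : ℂ))).mul (he (-k) y)).congr_deriv ?_
    simp only [Pi.add_apply]
    ring
  have hexp : ∀ y : ℝ, Complex.exp (-k * y) * Complex.exp (k * y) = 1 := fun y => by
    rw [← Complex.exp_add]; simp
  have hw : ∀ y : ℝ, 0 < y → HasDerivAt (fun y : ℝ => a y * Complex.exp (k * y))
      (B * Complex.exp (k * y) ^ 2) y := fun y hy => by
    refine ((ha y hy).mul (he k y)).congr_deriv ?_
    rw [← hB y hy]
    linear_combination (-(a' y + k * a y) * Complex.exp (k * y)) * hexp y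
  have hnorm : ∀ y : ℝ, ‖Complex.exp (k * y)‖ = Real.exp (k * y) := fun y => by
    rw [← Complex.ofReal_mul, ← Complex.ofReal_exp, Complex.norm_real, Real.norm_eq_abs,
      Real.abs_exp]
  have hB0 : B = 0 := by
    rcases hk.eq_or_lt with rfl | hk
    · obtain ⟨D, hD⟩ := hconst (fun y => a y * Complex.exp ((0 : ℝ) * y) - B * y) fun y hy => by
        refine ((hw y hy).sub (((hasDerivAt_id y).ofReal_comp).const_mul B)).congr_deriv ?_
        simp
      by_contra hne
      have hpos : 0 < ‖B‖ := norm_pos_iff.2 hne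
      obtain ⟨y, hy⟩ := exists_gt (max 1 ((M + ‖D‖) / ‖B‖))
      have hy1 := (le_max_left _ _).trans_lt hy
      have hy2 := (le_max_right _ _).trans_lt hy
      rw [div_lt_iff₀ hpos] at hy2
      have h1 : B * y = a y - D := by
        rw [← hD y (by linarith)]; simp
      have h2 := norm_sub_le (a y) D
      rw [← h1, norm_mul, Complex.norm_real, Real.norm_of_nonneg (by linarith)] at h2
      linarith [hM y hy1.le]
    · obtain ⟨D, hD⟩ := hconst
        (fun y => a y * Complex.exp (k * y) - B / (2 * k) * Complex.exp (k * y) ^ 2) fun y hy => by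
        refine ((hw y hy).sub (((he k y).pow 2).const_mul (B / (2 * k)))).congr_deriv ?_
        have : (k : ℂ) ≠ 0 := by exact_mod_cast hk.ne'
        field_simp
        ring
      by_contra hne
      have hpos : 0 < ‖B / (2 * k)‖ := norm_pos_iff.2
        (div_ne_zero hne (mul_ne_zero two_ne_zero (by exact_mod_cast hk.ne')))
      obtain ⟨y, hy⟩ := exists_gt (max 1 ((M + ‖D‖) / ‖B / (2 * k)‖ / k))
      have hy1 := (le_max_left _ _).trans_lt hy
      have hy2 := (le_max_right _ _).trans_lt hy
      rw [div_lt_iff₀ hk, div_lt_iff₀ hpos] at hy2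
      have h1 : B / (2 * k) * Complex.exp (k * y) ^ 2 = a y * Complex.exp (k * y) - D := by
        rw [← hD y (by linarith)]; ring
      have h2 := norm_sub_le (a y * Complex.exp (k * y)) D
      rw [← h1, norm_mul, norm_mul, norm_pow, hnorm] at h2
      have h3 := Real.add_one_le_exp (k * y)
      have h4 : 0 < k * y := mul_pos hk (by linarith)
      have h5 := hM y hy1.le
      have h6 := norm_nonneg D
      set E := Real.exp (k * y)
      have hE : 1 ≤ E := by linarith
      have h7 : ‖B / (2 * k)‖ * E ^ 2 ≤ (M + ‖D‖) * E := by nlinarith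
      have h8 : ‖B / (2 * k)‖ * E ≤ M + ‖D‖ := by
        refine le_of_mul_le_mul_right ?_ (by linarith : 0 < E)
        linarith
      nlinarith
  obtain ⟨c, hc⟩ := hconst (fun y => a y * Complex.exp (k * y)) fun y hy => by
    simpa [hB0] using hw y hy
  refine ⟨c, fun y hy => ?_⟩
  rw [← hc y hy, mul_assoc, ← Complex.exp_add]
  simp

/-- The `n`-th Fourier coefficient of `x ↦ h (x + iy)` over one period. -/
def rowCoeff (h : ℂ → ℂ) (n : ℤ) (y : ℝ) : ℂ :=
  1 / 2 * ∫ x in (0 : ℝ)..2,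
    Complex.exp (-(Complex.I * Real.pi * n * x)) * h (x + y * Complex.I)

theorem norm_rowCoeff_le {h : ℂ → ℂ} {y B : ℝ} (hB : ∀ x : ℝ, ‖h (x + y * Complex.I)‖ ≤ B)
    (n : ℤ) : ‖rowCoeff h n y‖ ≤ B := by
  have hexp : ∀ x : ℝ, ‖Complex.exp (-(Complex.I * Real.pi * n * x))‖ = 1 := fun x => by
    rw [Complex.norm_exp]; simp
  have := intervalIntegral.norm_integral_le_of_norm_le_const (a := (0 : ℝ)) (b := 2) (C := B)
    (f := fun x : ℝ => Complex.exp (-(Complex.I * Real.pi * n * x)) * h (x + y * Complex.I))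
    fun x _ => by rw [norm_mul, hexp, one_mul]; exact hB x
  rw [rowCoeff, norm_mul]
  norm_num at this ⊢
  linarith

theorem periodic_row {h : ℂ → ℂ} (hper : ∀ τ : ℂ, 0 < τ.im → h (τ + 2) = h τ) {y : ℝ}
    (hy : 0 < y) : Function.Periodic (fun x : ℝ => h (x + y * Complex.I)) 2 := fun x => by
  beta_reduce
  rw [← hper (x + y * Complex.I) (by simpa using hy)]
  push_cast
  ring_nf

/-- The row coefficients of a harmonic periodic function solve `d²a/dy² = (πn)² a`, so
boundedness near `i∞` leaves only the decaying solution. -/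
theorem HarmonicOnH.exists_rowCoeff_eq {h : ℂ → ℂ} (hharm : HarmonicOnH h)
    (hper : ∀ τ : ℂ, 0 < τ.im → h (τ + 2) = h τ) {M : ℝ}
    (hM : ∀ τ : ℂ, 1 ≤ τ.im → ‖h τ‖ ≤ M) (n : ℤ) :
    ∃ c : ℂ, ∀ y : ℝ, 0 < y →
      rowCoeff h n y = c * Complex.exp (-((Real.pi * |(n : ℝ)| : ℝ) * y)) := by
  set u : ℝ × ℝ → ℂ := fun p => h (p.1 + p.2 * Complex.I)
  set ux : ℝ × ℝ → ℂ := fun p => fderiv ℝ u p (1, 0)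
  set uy : ℝ × ℝ → ℂ := fun p => fderiv ℝ u p (0, 1)
  obtain ⟨hC2, hlap⟩ := hharm
  have hC1 : ContDiffOn ℝ 1 u {p | 0 < p.2} := hC2.of_le (by norm_num)
  have hf : ContDiffOn ℝ 1 (fderiv ℝ u) {p | 0 < p.2} :=
    hC2.fderiv_of_isOpen isOpen_setOf_snd_pos (by norm_num)
  have huxC : ContDiffOn ℝ 1 ux {p | 0 < p.2} := hf.clm_apply contDiffOn_const
  have huyC : ContDiffOn ℝ 1 uy {p | 0 < p.2} := hf.clm_apply contDiffOn_const
  have dux : ∀ {y : ℝ}, 0 < y → ∀ x : ℝ, HasDerivAt (fun x' => u (x', y)) (ux (x, y)) x :=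
    fun hy x => hasDerivAt_fst (hC1.differentiableAt_upper x hy)
  have duy : ∀ {y : ℝ}, 0 < y → ∀ x : ℝ, HasDerivAt (fun y' => u (x, y')) (uy (x, y)) y :=
    fun hy x => hasDerivAt_snd (hC1.differentiableAt_upper x hy)
  have duxx : ∀ {y : ℝ}, 0 < y → ∀ x : ℝ,
      HasDerivAt (fun x' => ux (x', y)) (fderiv ℝ ux (x, y) (1, 0)) x :=
    fun hy x => hasDerivAt_fst (huxC.differentiableAt_upper x hy)
  have duyy : ∀ {y : ℝ}, 0 < y → ∀ x : ℝ,
      HasDerivAt (fun y' => uy (x, y')) (fderiv ℝ uy (x, y) (0, 1)) y :=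
    fun hy x => hasDerivAt_snd (huyC.differentiableAt_upper x hy)
  have hlap' : ∀ {y : ℝ}, 0 < y → ∀ x : ℝ,
      fderiv ℝ uy (x, y) (0, 1) = -fderiv ℝ ux (x, y) (1, 0) := by
    intro y hy x
    have h1 := hlap (x + y * Complex.I) (by simpa using hy)
    have hre : ((x : ℂ) + y * Complex.I).re = x := by simp
    have him : ((x : ℂ) + y * Complex.I).im = y := by simp
    rw [hre, him] at h1
    have h2 : (fun x : ℝ => deriv (fun x' : ℝ => h ((x' : ℂ) + (y : ℂ) * Complex.I)) x) =
        fun x => ux (x, y) := funext fun x => (dux hy x).deriv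
    have h3 : (fun y : ℝ => deriv (fun y' : ℝ => h ((x : ℂ) + (y' : ℂ) * Complex.I)) y) =ᶠ[nhds y]
        fun y => uy (x, y) := by
      filter_upwards [lt_mem_nhds hy] with z hz using (duy hz x).deriv
    rw [h2, h3.deriv_eq, (duxx hy x).deriv, (duyy hy x).deriv] at h1
    linear_combination h1
  have hperu : ∀ {y : ℝ}, 0 < y → ∀ x : ℝ, u (x + 2, y) = u (x, y) := fun hy x =>
    periodic_row hper hy x
  have hperux : ∀ {y : ℝ}, 0 < y → ux (2, y) = ux (0, y) := by
    intro y hy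
    have h1 : HasDerivAt (fun x' => u (x' + 2, y)) (ux (0 + 2, y)) 0 :=
      (dux hy (0 + 2)).comp_add_const 0 2
    rw [zero_add, funext (hperu hy)] at h1
    exact h1.unique (dux hy 0)
  have hφ : Continuous fun x : ℝ => Complex.exp (-(Complex.I * Real.pi * n * x)) := by fun_prop
  refine exists_eq_mul_exp_of_bounded (M := M) (by positivity)
    (a' := fun y => 1 / 2 * ∫ x in (0 : ℝ)..2,
      Complex.exp (-(Complex.I * Real.pi * n * x)) * uy (x, y))
    (fun y hy => (hasDerivAt_integral_row hC1 hφ hy).const_mul _) (fun y hy => ?_) fun y hy => ?_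
  · refine ((hasDerivAt_integral_row huyC hφ hy).const_mul (1 / 2 : ℂ)).congr_deriv ?_
    have h1 := integral_exp_mul_deriv_of_periodic (dux hy) (huxC.continuousOn.comp_row hy)
      (by simpa using hperu hy 0) n
    have h2 := integral_exp_mul_deriv_of_periodic (duxx hy)
      ((huxC.continuousOn_fderiv_apply (1, 0)).comp_row hy) (hperux hy) n
    simp_rw [hlap' hy, mul_neg, intervalIntegral.integral_neg]
    rw [h2, h1]
    have h3 : (((Real.pi * |(n : ℝ)| : ℝ) : ℂ)) ^ 2 = (Real.pi * n) ^ 2 := by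
      rw [← Complex.ofReal_pow, mul_pow, sq_abs]
      push_cast
      ring
    rw [h3, rowCoeff]
    linear_combination (-(Real.pi * n) ^ 2 * (1 / 2) * ∫ x in (0 : ℝ)..2,
      Complex.exp (-(Complex.I * Real.pi * n * x)) * u (x, y)) * Complex.I_sq
  · exact norm_rowCoeff_le (fun x => hM _ (by simp [hy])) n

instance : Fact ((0 : ℝ) < 2) := ⟨two_pos⟩

theorem fourierTerm_eq (c : ℤ → ℂ) (τ : ℂ) (n : ℤ) :
    fourierTerm c τ n = c n * Complex.exp (-((Real.pi * |(n : ℝ)| : ℝ) * τ.im)) *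
      fourier n (τ.re : AddCircle (2 : ℝ)) := by
  rw [fourierTerm, fourier_coe_apply, mul_assoc (c n), ← Complex.exp_add]
  congr 2
  split_ifs with hn
  · rw [abs_of_nonneg (by exact_mod_cast hn)]
    conv_lhs => rw [← Complex.re_add_im τ]
    push_cast
    linear_combination (Real.pi * n * τ.im) * Complex.I_sq
  · rw [abs_of_neg (by exact_mod_cast not_le.1 hn)]
    conv_lhs => rw [← Complex.re_add_im τ]
    simp only [map_add, map_mul, Complex.conj_ofReal, Complex.conj_I]
    push_cast
    linear_combination (-Real.pi * n * τ.im) * Complex.I_sq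

theorem norm_fourierTerm (c : ℤ → ℂ) (τ : ℂ) (n : ℤ) :
    ‖fourierTerm c τ n‖ = ‖c n‖ * Real.exp (-(Real.pi * |(n : ℝ)| * τ.im)) := by
  have : ‖fourier n (τ.re : AddCircle (2 : ℝ))‖ = 1 := Circle.norm_coe _
  rw [fourierTerm_eq, norm_mul, norm_mul, this, mul_one, Complex.norm_exp]
  simp

theorem fourierCoeff_eq_rowCoeff {h : ℂ → ℂ} {y : ℝ} {f : AddCircle (2 : ℝ) → ℂ}
    (hf : ∀ x : ℝ, f x = h (x + y * Complex.I)) (n : ℤ) : fourierCoeff f n = rowCoeff h n y := by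
  rw [fourierCoeff_eq_intervalIntegral f n 0, rowCoeff, zero_add, Complex.real_smul]
  push_cast
  congr 2
  ext x
  rw [fourier_coe_apply, hf, smul_eq_mul]
  congr 2
  push_cast
  ring

/-- An absolutely convergent trigonometric series is the Fourier series of its sum. -/
theorem fourierCoeff_of_hasSum {T : ℝ} [Fact (0 < T)] {d : ℤ → ℂ} (hd : Summable fun n => ‖d n‖)
    {f : AddCircle T → ℂ} (hf : ∀ x, HasSum (fun n => d n * fourier n x) (f x)) :
    fourierCoeff f = d := by
  ext m
  have hn : ∀ (k : ℤ) (t : AddCircle T), ‖fourier k t‖ = 1 := fun k t => Circle.norm_coe _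
  have hi : ∀ n, Integrable (fun t : AddCircle T => fourier (-m) t * (d n * fourier n t))
      AddCircle.haarAddCircle := fun n =>
    Continuous.integrable_of_hasCompactSupport (by fun_prop) (HasCompactSupport.of_compactSpace _)
  have key := hasSum_integral_of_summable_integral_norm hi (by
    simpa only [norm_mul, hn, one_mul, mul_one, integral_const, probReal_univ, one_smul] using hd)
  have hterm : ∀ n, ∫ t : AddCircle T, fourier (-m) t * (d n * fourier n t)
      ∂AddCircle.haarAddCircle = if n = m then d n else 0 := by
    intro n
    have h1 : ∫ t : AddCircle T, fourier (-m) t * (d n * fourier n t) ∂AddCircle.haarAddCircle =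
        d n * fourierCoeff (T := T) (fourier n) m := by
      rw [fourierCoeff, ← integral_const_mul]
      simp_rw [smul_eq_mul]
      congr 1
      ext t
      ring
    rw [h1, fourierCoeff_fourier, Pi.single_apply]
    simp [eq_comm]
  simp_rw [hterm] at key
  have h2 : (fun n => if n = m then d n else 0) = fun n => if n = m then d m else 0 := by
    ext n
    split_ifs with hnm <;> simp [hnm]
  rw [h2] at key
  rw [← key.unique (hasSum_ite_eq m (d m)), fourierCoeff]
  simp_rw [tsum_mul_left, (hf _).tsum_eq, smul_eq_mul]

/-- The coefficients of a harmonic Fourier expansion are determined by the row at height one. -/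
theorem FourierExpansion.coeff_mul_exp {c : ℤ → ℂ} {h : ℂ → ℂ} (hc : FourierExpansion c h)
    (hper : ∀ τ : ℂ, 0 < τ.im → h (τ + 2) = h τ) (n : ℤ) {y : ℝ} (hy : 0 < y) :
    c n * Complex.exp (-((Real.pi * |(n : ℝ)| : ℝ) * y)) = rowCoeff h n y := by
  have hp := periodic_row hper hy
  have hlift : ∀ x : ℝ, hp.lift x = h (x + y * Complex.I) := fun x => hp.lift_coe x
  rw [← fourierCoeff_eq_rowCoeff hlift n]
  refine (congrFun (fourierCoeff_of_hasSum
    (d := fun n => c n * Complex.exp (-((Real.pi * |(n : ℝ)| : ℝ) * y))) ?_ fun x => ?_) n).symm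
  · convert hc.2.1 (y * Complex.I) (by simpa using hy) using 2 with n
    rw [norm_fourierTerm, norm_mul, Complex.norm_exp]
    simp
  · induction x using QuotientAddGroup.induction_on with
    | H x =>
      convert hc.1 (x + y * Complex.I) (by simpa using hy) using 2 with n
      · rw [fourierTerm_eq]
        simp
      · exact hlift x

theorem summable_exp_neg_mul_abs_int {r : ℝ} (hr : 0 < r) :
    Summable fun n : ℤ => Real.exp (-(r * |(n : ℝ)|)) := by
  have h : Summable fun n : ℕ => Real.exp (-(r * (n : ℝ))) := by
    simpa [mul_comm] using Real.summable_exp_nat_mul_iff.2 (neg_lt_zero.2 hr)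
  exact .of_nat_of_neg (by simpa using h) (by simpa using h)

/-- A harmonic, 2-periodic `h : ℍ → ℂ` with
`|h(τ)| = O(exp(πβ/Im τ))` has a unique harmonic Fourier series expansion, and its
coefficients satisfy `|cₙ| = O(exp(2π√(β|n|)))` as `|n| → ∞`. -/
theorem statement9 (β : ℝ) (hβ : 0 < β) (h : ℂ → ℂ)
    (hharm : HarmonicOnH h)
    (hper : ∀ τ : ℂ, 0 < τ.im → h (τ + 2) = h τ)
    (hgrow : ∃ C : ℝ, ∀ τ : ℂ, 0 < τ.im → ‖h τ‖ ≤ C * Real.exp (Real.pi * β / τ.im)) :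
    ∃ c : ℤ → ℂ, FourierExpansion c h ∧
      (∃ C N : ℝ, ∀ n : ℤ, N ≤ |(n : ℝ)| →
        ‖c n‖ ≤ C * Real.exp (2 * Real.pi * Real.sqrt (β * |(n : ℝ)|))) ∧
      ∀ c' : ℤ → ℂ, FourierExpansion c' h → c' = c := by
  obtain ⟨C, hC⟩ := hgrow
  have hC0 : 0 ≤ C := nonneg_of_mul_nonneg_left
    ((norm_nonneg _).trans (hC Complex.I (by simp))) (Real.exp_pos _)
  have hM : ∀ τ : ℂ, 1 ≤ τ.im → ‖h τ‖ ≤ C * Real.exp (Real.pi * β) := fun τ hτ => by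
    refine (hC τ (by linarith)).trans ?_
    gcongr
    exact div_le_self (by positivity) hτ
  choose c hc using hharm.exists_rowCoeff_eq hper hM
  have hbound : ∀ (n : ℤ) {y : ℝ}, 0 < y →
      ‖c n‖ ≤ C * Real.exp (Real.pi * β / y + Real.pi * |(n : ℝ)| * y) := by
    intro n y hy
    have h1 : ‖rowCoeff h n y‖ ≤ C * Real.exp (Real.pi * β / y) :=
      norm_rowCoeff_le (fun x => by simpa using hC (x + y * Complex.I) (by simpa using hy)) n
    rw [hc n y hy, norm_mul, Complex.norm_exp] at h1
    have h2 : (-(((Real.pi * |(n : ℝ)| : ℝ) : ℂ) * y)).re = -(Real.pi * |(n : ℝ)| * y) := by simp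
    rw [h2, Real.exp_neg, ← div_eq_mul_inv, div_le_iff₀ (Real.exp_pos _)] at h1
    rwa [Real.exp_add, ← mul_assoc]
  have hterm : ∀ {y₀ : ℝ}, 0 < y₀ → ∀ (n : ℤ) (τ : ℂ), y₀ ≤ τ.im → ‖fourierTerm c τ n‖ ≤
      C * Real.exp (Real.pi * β / (y₀ / 2)) * Real.exp (-(Real.pi * y₀ / 2 * |(n : ℝ)|)) := by
    intro y₀ hy₀ n τ hτ
    rw [norm_fourierTerm]
    calc _ ≤ C * Real.exp (Real.pi * β / (y₀ / 2) + Real.pi * |(n : ℝ)| * (y₀ / 2)) *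
          Real.exp (-(Real.pi * |(n : ℝ)| * y₀)) := by
          gcongr
          exact hbound n (half_pos hy₀)
      _ = _ := by
          rw [mul_assoc C, mul_assoc C, ← Real.exp_add, ← Real.exp_add]
          congr 2
          ring
  have hsumm : ∀ {y₀ : ℝ}, 0 < y₀ → Summable fun n : ℤ =>
      C * Real.exp (Real.pi * β / (y₀ / 2)) * Real.exp (-(Real.pi * y₀ / 2 * |(n : ℝ)|)) :=
    fun hy₀ => (summable_exp_neg_mul_abs_int (by positivity)).mul_left _
  have habs : ∀ τ : ℂ, 0 < τ.im → Summable fun n : ℤ => ‖fourierTerm c τ n‖ := fun τ hτ =>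
    .of_nonneg_of_le (fun _ => norm_nonneg _) (fun n => hterm hτ n τ le_rfl) (hsumm hτ)
  have hsum : ∀ τ : ℂ, 0 < τ.im → HasSum (fun n : ℤ => fourierTerm c τ n) (h τ) := by
    intro τ hτ
    have hp := periodic_row hper hτ
    have hcont : Continuous hp.lift :=
      continuous_coinduced_dom.mpr (hharm.1.continuousOn.comp_row hτ)
    let f : C(AddCircle (2 : ℝ), ℂ) := ⟨hp.lift, hcont⟩
    have hf : ∀ x : ℝ, f x = h (x + τ.im * Complex.I) := fun x => hp.lift_coe x
    have hcoeff : ∀ n, fourierCoeff f n =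
        c n * Complex.exp (-((Real.pi * |(n : ℝ)| : ℝ) * τ.im)) := fun n => by
      rw [fourierCoeff_eq_rowCoeff hf, hc n _ hτ]
    have hs : Summable (fourierCoeff f) := by
      refine .of_norm ?_
      convert habs τ hτ using 2 with n
      rw [hcoeff, norm_fourierTerm, norm_mul, Complex.norm_exp]
      simp
    convert has_pointwise_sum_fourier_series_of_summable hs τ.re using 1
    · ext n
      rw [fourierTerm_eq, hcoeff, smul_eq_mul]
    · rw [hf, Complex.re_add_im]
  refine ⟨c, ⟨hsum, habs, fun K hK hKc => ?_⟩, ⟨C, 1, fun n hn => ?_⟩, fun c' hc' => ?_⟩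
  · rcases K.eq_empty_or_nonempty with rfl | hne
    · exact tendstoUniformlyOn_empty
    · obtain ⟨z, hz, hmin⟩ := hKc.exists_isMinOn hne Complex.continuous_im.continuousOn
      exact (tendstoUniformlyOn_tsum (hsumm (hK hz)) fun n τ hτ =>
        hterm (hK hz) n τ (hmin hτ)).congr_right fun τ hτ => (hsum τ (hK hτ)).tsum_eq
  · have hn0 : 0 < |(n : ℝ)| := by linarith
    have hs : 0 < √(β * |(n : ℝ)|) := Real.sqrt_pos.2 (by positivity)
    have hsq := Real.sq_sqrt (by positivity : 0 ≤ β * |(n : ℝ)|)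
    convert hbound n (div_pos hs hn0) using 3
    field_simp
    linear_combination hsq
  · ext n
    have h1 := (hc'.coeff_mul_exp hper n one_pos).trans (hc n 1 one_pos)
    exact mul_right_cancel₀ (Complex.exp_ne_zero _) h1

end
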